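/- Let ν > 0, γ ≥ 0, 0 < α < T, and d ≥ 0 be real numbers; set σ = √(d² + ν⁻¹), a = σα, b = σ(T − α). If α ≤ T/2 or γ = 0, then ν·(σ·coth(a) + d)·(σ·coth(b) + d + γ·ν⁻¹) / (1 + γ(σ·coth(b) − d)) > 1. -/

import Mathlib

noncomputable def coth (x : ℝ) : ℝ := Real.cosh x / Real.sinh x

theorem one_lt_coth_aux (x : ℝ) (hx : 0 < x) : 1 < coth x := by
  unfold coth
  rw [one_lt_div (Real.sinh_pos_iff.2 hx)]
  exact Real.sinh_lt_cosh x

theorem coth_anti_aux (a b : ℝ) (ha : 0 < a) (hab : a ≤ b) : coth b ≤ coth a := by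
  unfold coth
  rw [div_le_div_iff₀ (Real.sinh_pos_iff.2 (ha.trans_le hab)) (Real.sinh_pos_iff.2 ha)]
  have h : 0 ≤ Real.sinh (b - a) := Real.sinh_nonneg_iff.2 (sub_nonneg.2 hab)
  rw [Real.sinh_sub] at h
  linarith

theorem sd2_divergence (ν γ α T d : ℝ) (hν : 0 < ν) (hγ : 0 ≤ γ)
    (hα : 0 < α) (hαT : α < T) (hd : 0 ≤ d)
    (h : α ≤ T / 2 ∨ γ = 0) :
    1 < ν * (Real.sqrt (d ^ 2 + ν⁻¹) * coth (Real.sqrt (d ^ 2 + ν⁻¹) * α) + d) *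
        (Real.sqrt (d ^ 2 + ν⁻¹) * coth (Real.sqrt (d ^ 2 + ν⁻¹) * (T - α)) + d + γ * ν⁻¹) /
      (1 + γ * (Real.sqrt (d ^ 2 + ν⁻¹) * coth (Real.sqrt (d ^ 2 + ν⁻¹) * (T - α)) - d)) := by
  have hi : 0 < ν⁻¹ := inv_pos.2 hν
  have hsq : Real.sqrt (d ^ 2 + ν⁻¹) ^ 2 = d ^ 2 + ν⁻¹ := Real.sq_sqrt (by positivity)
  have hs : 0 < Real.sqrt (d ^ 2 + ν⁻¹) := Real.sqrt_pos.2 (by positivity)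
  generalize Real.sqrt (d ^ 2 + ν⁻¹) = s at *
  have hds : d < s := by nlinarith
  have hA := one_lt_coth_aux (s * α) (by positivity)
  have hB := one_lt_coth_aux (s * (T - α)) (mul_pos hs (by linarith))
  have hA' : s < s * coth (s * α) := by nlinarith
  have hB' : s < s * coth (s * (T - α)) := by nlinarith
  have hAB : γ * (s * coth (s * (T - α))) ≤ γ * (s * coth (s * α)) := by
    rcases h with h | h
    · have := coth_anti_aux (s * α) (s * (T - α)) (by positivity)
        (mul_le_mul_of_nonneg_left (by linarith) hs.le)
      gcongr
    · simp [h]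
  generalize s * coth (s * α) = A at *
  generalize s * coth (s * (T - α)) = B at *
  have hD : 0 < 1 + γ * (B - d) := by
    have := mul_nonneg hγ (show 0 ≤ B - d by linarith)
    linarith
  rw [one_lt_div hD]
  have e : ν * (A + d) * (B + d + γ * ν⁻¹) = ν * ((A + d) * (B + d)) + γ * (A + d) := by
    field_simp
  have h1 : ν⁻¹ < (A + d) * (B + d) := by
    have : s * s < (A + d) * (B + d) :=
      mul_lt_mul'' (by linarith) (by linarith) hs.le hs.le
    nlinarith [sq_nonneg d]
  have h2 : 1 < ν * ((A + d) * (B + d)) := by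
    have := mul_lt_mul_of_pos_left h1 hν
    rwa [mul_inv_cancel₀ hν.ne'] at this
  rw [e]
  nlinarith [mul_nonneg hγ hd]
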